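/- For every Büchi automaton A, the statically computed relation ⪯^R is contained in the odd-rank simulation: ⪯^R ⊆ ⪯. -/

import Mathlib

/-!
Common definitions: Büchi automata, runs, languages, run DAGs and their ranks,
level rankings, tight rankings, the Schewe complementation construction and its
optimizations (Delay, SuccRank, RankSim, RankRestr, MaxRank).
-/

noncomputable section
open scoped Classical

/-- A (nondeterministic) Büchi automaton with alphabet `A` and state type `Q`. -/
structure BA (A : Type*) (Q : Type*) where
  /-- transition function -/
  δ : Q → A → Set Q
  /-- initial states -/
  I : Set Q
  /-- accepting states -/
  F : Set Q

/-- Macrostates of the rank-based complement: the waiting part `wait S` and the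
tight part `tight S O f i`. -/
inductive Mac (Q : Type*) where
  | wait : Set Q → Mac Q
  | tight : Set Q → Set Q → (Q → ℕ) → ℕ → Mac Q

namespace Mac

variable {Q : Type*}

/-- The `S`-component of a macrostate. -/
def S : Mac Q → Set Q
  | wait S => S
  | tight S _ _ _ => S

/-- The `O`-component of a macrostate (defaulting to `∅` on the waiting part). -/
def Oc : Mac Q → Set Q
  | wait _ => ∅
  | tight _ O _ _ => O

/-- The ranking component of a macrostate (defaulting to `0` on the waiting part). -/
def fc : Mac Q → Q → ℕ
  | wait _ => fun _ => 0
  | tight _ _ f _ => f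

/-- The `i`-component of a macrostate (defaulting to `0` on the waiting part). -/
def ic : Mac Q → ℕ
  | wait _ => 0
  | tight _ _ _ i => i

end Mac

namespace BA

variable {A : Type*} {Q : Type*}

/-- Transition function extended to sets of states. -/
def δS (M : BA A Q) (S : Set Q) (a : A) : Set Q := ⋃ q ∈ S, M.δ q a

/-- `ρ` is a run of `M` on the infinite word `w`, starting in an initial state. -/
def IsRun (M : BA A Q) (w : ℕ → A) (ρ : ℕ → Q) : Prop :=
  ρ 0 ∈ M.I ∧ ∀ i, ρ (i + 1) ∈ M.δ (ρ i) (w i)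

/-- A run is accepting iff it visits the accepting states infinitely often. -/
def Accepting (M : BA A Q) (ρ : ℕ → Q) : Prop :=
  ∀ n, ∃ i, n ≤ i ∧ ρ i ∈ M.F

/-- The ω-language of `M`. -/
def Lang (M : BA A Q) : Set (ℕ → A) :=
  {w | ∃ ρ, M.IsRun w ρ ∧ M.Accepting ρ}

/-! ### Run DAGs and ranks of their vertices -/

/-- Vertices of the run DAG of `M` over `w`: `(q, i)` is a vertex iff some run of `M`
from `I` over `w` is at `q` at time `i`. -/
def dagV (M : BA A Q) (w : ℕ → A) : Set (Q × ℕ) :=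
  {v | ∃ ρ, M.IsRun w ρ ∧ ρ v.2 = v.1}

/-- Edges of the run DAG of `M` over `w`. -/
def dagEdge (M : BA A Q) (w : ℕ → A) (u v : Q × ℕ) : Prop :=
  u ∈ M.dagV w ∧ v ∈ M.dagV w ∧ v.2 = u.2 + 1 ∧ v.1 ∈ M.δ u.1 (w u.2)

/-- `v` is reachable from `u` inside the subgraph of the run DAG induced by the
vertex set `U`. -/
def reachIn (M : BA A Q) (w : ℕ → A) (U : Set (Q × ℕ)) (u v : Q × ℕ) : Prop :=
  u ∈ U ∧ Relation.ReflTransGen (fun x y => y ∈ U ∧ M.dagEdge w x y) u v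

/-- The decreasing sequence of subgraphs `G⁰ ⊇ G¹ ⊇ …` used to assign ranks:
at an even stage `j` the *finite* vertices (those with finitely many vertices
reachable from them) are removed (getting rank `j`), at an odd stage `j` the
*endangered* vertices (those which cannot reach an accepting vertex) are removed
(getting rank `j`). -/
def dagG (M : BA A Q) (w : ℕ → A) : ℕ → Set (Q × ℕ)
  | 0 => M.dagV w
  | j + 1 =>
      if Even j then
        {v ∈ M.dagG w j | ¬ Set.Finite {v' | M.reachIn w (M.dagG w j) v v'}}
      else
        {v ∈ M.dagG w j | ∃ v', M.reachIn w (M.dagG w j) v v' ∧ v'.1 ∈ M.F}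

/-- The rank of a vertex of the run DAG of `M` over `w`: the stage at which the
vertex is removed, or `⊤` (i.e. ω) if it is never removed. -/
def dagRank (M : BA A Q) (w : ℕ → A) (v : Q × ℕ) : ℕ∞ :=
  sInf {j : ℕ∞ | ∃ n : ℕ, j = (n : ℕ∞) ∧ v ∈ M.dagG w n ∧ v ∉ M.dagG w (n + 1)}

/-! ### Simulations -/

/-- `R` is a direct simulation relation on `M`. -/
def IsDirSimRel (M : BA A Q) (R : Q → Q → Prop) : Prop :=
  ∀ p r, R p r → (p ∈ M.F → r ∈ M.F) ∧
    ∀ a : A, ∀ p' ∈ M.δ p a, ∃ r' ∈ M.δ r a, R p' r'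

/-- The (maximum) direct simulation `⊑_di` on `M`: the largest direct simulation
relation, i.e. the union of all direct simulation relations. -/
def DirSim (M : BA A Q) (p r : Q) : Prop :=
  ∃ R, M.IsDirSimRel R ∧ R p r

/-- The odd-rank simulation `⪯` on `M`: `p ⪯ r` iff for every word `w` and every
position `i` such that `(p,i)` and `(r,i)` are vertices of the run DAG of `M`
over `w`, if both ranks are (finite and) odd then `rank_w(p,i) ≤ rank_w(r,i)`. -/
def OddRankSim (M : BA A Q) (p r : Q) : Prop :=
  ∀ w : ℕ → A, ∀ i : ℕ, (p, i) ∈ M.dagV w → (r, i) ∈ M.dagV w →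
    ∀ np nr : ℕ, M.dagRank w (p, i) = (np : ℕ∞) → M.dagRank w (r, i) = (nr : ℕ∞) →
      Odd np → Odd nr → np ≤ nr

/-- The statically computed relation `⪯^R`: the smallest relation containing the
direct simulation and such that whenever for every letter `a` every state of
`δ(p,a)∖F` is related to every state of `δ(r,a)∖F`, also `p` is related to `r`. -/
inductive RatSim (M : BA A Q) : Q → Q → Prop
  | base {p r : Q} : M.DirSim p r → RatSim M p r
  | step {p r : Q} :
      (∀ a : A, ∀ x ∈ M.δ p a \ M.F, ∀ y ∈ M.δ r a \ M.F, RatSim M x y) →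
      RatSim M p r

/-! ### Level rankings and tightness -/

variable [Fintype Q]

/-- The rank of a ranking `f`, i.e. `max {f q | q : Q}`. -/
def rankOf (f : Q → ℕ) : ℕ := Finset.univ.sup f

/-- `f` is a level ranking for `M`: it is bounded by `2n` and assigns even ranks to
accepting states. -/
def IsLevelRanking (M : BA A Q) (f : Q → ℕ) : Prop :=
  (∀ q, f q ≤ 2 * Fintype.card Q) ∧ ∀ q ∈ M.F, Even (f q)

/-- `f` is an `S`-tight level ranking: its rank is odd, every odd number up to its
rank is attained on `S`, and `f` is `0` outside of `S`. -/
def IsTight (M : BA A Q) (S : Set Q) (f : Q → ℕ) : Prop :=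
  M.IsLevelRanking f ∧ Odd (rankOf f) ∧
  (∀ j, Odd j → j ≤ rankOf f → ∃ s ∈ S, f s = j) ∧
  ∀ q ∉ S, f q = 0

/-- Membership of `(S, O, f, i)` in the tight part `Q₂` of the Schewe construction. -/
def InQ2 (M : BA A Q) (S O : Set Q) (f : Q → ℕ) (i : ℕ) : Prop :=
  M.IsTight S f ∧ O ⊆ S ∩ {q | f q = i} ∧ Even i ∧ i + 2 ≤ 2 * Fintype.card Q

/-- The `δ₃` transition relation of the Schewe construction (on the raw components). -/
def Delta3 (M : BA A Q) (S O : Set Q) (f : Q → ℕ) (i : ℕ) (a : A)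
    (S' O' : Set Q) (f' : Q → ℕ) (i' : ℕ) : Prop :=
  S' = M.δS S a ∧ (∀ q ∈ S, ∀ q' ∈ M.δ q a, f' q' ≤ f q) ∧
  rankOf f' = rankOf f ∧
  ((O = ∅ ∧ i' = (i + 2) % (rankOf f' + 1) ∧ O' = {q | f' q = i'}) ∨
   (O ≠ ∅ ∧ i' = i ∧ O' = M.δS O a ∩ {q | f' q = i'}))

/-! ### The Schewe construction -/

/-- The transition function of `Schewe(M)`. -/
def scheweDelta (M : BA A Q) : Mac Q → A → Set (Mac Q)
  | .wait S, a =>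
      {Mac.wait (M.δS S a)} ∪
      {m | ∃ f, m = Mac.tight (M.δS S a) ∅ f 0 ∧ M.InQ2 (M.δS S a) ∅ f 0}
  | .tight S O f i, a =>
      {m | ∃ S' O' f' i', m = Mac.tight S' O' f' i' ∧ M.InQ2 S' O' f' i' ∧
           M.Delta3 S O f i a S' O' f' i'}

/-- The accepting macrostates of `Schewe(M)`: the empty waiting macrostate, and the
tight macrostates with empty `O`-component. -/
def scheweAccept (M : BA A Q) : Set (Mac Q) :=
  {Mac.wait (∅ : Set Q)} ∪ {m | ∃ S f i, m = Mac.tight S ∅ f i ∧ M.InQ2 S ∅ f i}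

/-- The Schewe complement automaton `Schewe(M)`. -/
def schewe (M : BA A Q) : BA A (Mac Q) :=
  ⟨M.scheweDelta, {Mac.wait M.I}, M.scheweAccept⟩

/-- The run `ρ` of the complement construction moves from the waiting part to the
tight part at position `m`. -/
def SwitchesAt (ρ : ℕ → Mac Q) (m : ℕ) : Prop :=
  (∀ k ≤ m, ∃ S, ρ k = Mac.wait S) ∧ ∀ k, m < k → ∃ S O f i, ρ k = Mac.tight S O f i

/-- A run of the complement construction (switching to the tight part at `m`) is
super-tight if in the tight part its rankings coincide with the ranks of the
corresponding vertices of the run DAG of `M` over `w`. -/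
def SuperTight (M : BA A Q) (w : ℕ → A) (ρ : ℕ → Mac Q) (m : ℕ) : Prop :=
  ∀ k, m < k → ∀ q ∈ (ρ k).S, (((ρ k).fc q : ℕ∞)) = M.dagRank w (q, k)

/-! ### Tight cores and trunks -/

/-- `C` is a tight core of the ranking `f`: `f(C) = {1, 3, …, rank f}` and `f` is
injective on `C`. -/
def TightCore (f : Q → ℕ) (C : Set Q) : Prop :=
  f '' C = {j | Odd j ∧ j ≤ rankOf f} ∧ Set.InjOn f C

/-- `τ` is a trunk of the run `ρ` (switching at `m`): for every `k > m`, `τ k` is a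
tight core of the macrostate `ρ k` and there is a bijection `θ : τ k → τ (k+1)`
respecting the transition function. -/
def IsTrunk (M : BA A Q) (w : ℕ → A) (ρ : ℕ → Mac Q) (m : ℕ) (τ : ℕ → Set Q) : Prop :=
  ∀ k, m < k → τ k ⊆ (ρ k).S ∧ TightCore ((ρ k).fc) (τ k) ∧
    ∃ θ : Q → Q, Set.BijOn θ (τ k) (τ (k + 1)) ∧ ∀ q ∈ τ k, θ q ∈ M.δ q (w k)

/-! ### The Delay optimization -/

/-- Iterated (deterministic) successor of a set of states along a finite word. -/
def dSteps (M : BA A Q) : List A → Set Q → Set Q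
  | [], S => S
  | a :: u, S => M.dSteps u (M.δS S a)

/-- The `δ₁`-transition `S →a δ(S,a)` closes a cycle in the waiting part, i.e. `S` is
reachable from `δ(S,a)` in the deterministic subset automaton. -/
def ClosesCycle (M : BA A Q) (S : Set Q) (a : A) : Prop :=
  ∃ u : List A, M.dSteps u (M.δS S a) = S

/-- The transition function of `Delay(M)`: the waiting-to-tight transitions are only
kept when the corresponding waiting transition closes a cycle. -/
def delayDelta (M : BA A Q) : Mac Q → A → Set (Mac Q)
  | .wait S, a =>
      {Mac.wait (M.δS S a)} ∪
      {m | M.ClosesCycle S a ∧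
           ∃ f, m = Mac.tight (M.δS S a) ∅ f 0 ∧ M.InQ2 (M.δS S a) ∅ f 0}
  | .tight S O f i, a => M.scheweDelta (Mac.tight S O f i) a

/-- The `Delay(M)` automaton. -/
def delay (M : BA A Q) : BA A (Mac Q) :=
  ⟨M.delayDelta, {Mac.wait M.I}, M.scheweAccept⟩

/-! ### The SuccRank optimization -/

/-- Iterated successor of a set of states along an infinite word. -/
def dIter (M : BA A Q) (w : ℕ → A) (S : Set Q) : ℕ → Set Q
  | 0 => S
  | n + 1 => M.δS (M.dIter w S n) (w n)

/-- `infreach S`: the sets of states occurring infinitely often on some infinite path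
of the deterministic subset automaton starting in `S` (equivalently, the union of
all strongly connected components reachable from `S`). -/
def infreach (M : BA A Q) (S : Set Q) : Set (Set Q) :=
  {R | ∃ w : ℕ → A, ∀ m : ℕ, ∃ n, m ≤ n ∧ M.dIter w S n = R}

/-- `maxinfreach S = max {|R ∖ F| : R ∈ infreach S}`. -/
def maxinfreach (M : BA A Q) (S : Set Q) : ℕ :=
  sSup {n | ∃ R ∈ M.infreach S, n = (R \ M.F).ncard}

/-- `mininfreach S = min {|R ∖ F| : R ∈ infreach S}`. -/
def mininfreach (M : BA A Q) (S : Set Q) : ℕ :=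
  sInf {n | ∃ R ∈ M.infreach S, n = (R \ M.F).ncard}

/-- The coarse SuccRank condition: `rank f ≤ 2·maxinfreach S − 1`. -/
def CondCoarse (M : BA A Q) (S : Set Q) (f : Q → ℕ) : Prop :=
  (rankOf f : ℤ) ≤ 2 * (M.maxinfreach S : ℤ) - 1

/-- The fine SuccRank condition:
`rank f ≤ min {f q + 2·(maxinfreach S − mininfreach {q}) : q ∈ S}`. -/
def CondFine (M : BA A Q) (S : Set Q) (f : Q → ℕ) : Prop :=
  ∀ q ∈ S, (rankOf f : ℤ) ≤ (f q : ℤ) + 2 * ((M.maxinfreach S : ℤ) - (M.mininfreach {q} : ℤ))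

/-- `Schewe(M)` with the tight-part macrostates restricted to those satisfying `P`. -/
def restrictTight (M : BA A Q) (P : Set Q → Set Q → (Q → ℕ) → ℕ → Prop) : BA A (Mac Q) :=
  ⟨fun m a => {m' | m' ∈ M.scheweDelta m a ∧ ∀ S O f i, m' = Mac.tight S O f i → P S O f i},
   {Mac.wait M.I},
   {m | m ∈ M.scheweAccept ∧ ∀ S O f i, m = Mac.tight S O f i → P S O f i}⟩

/-! ### The RankSim optimization -/

/-- The RankSim condition on a macrostate with components `S` and `f`, with respect to
the odd-rank simulation `⪯`: whenever `p (⪯_f)⁺ r` for `p, r ∈ S`, also `f p ≤ f r`. -/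
def RankSimCond (M : BA A Q) (S : Set Q) (f : Q → ℕ) : Prop :=
  ∀ p ∈ S, ∀ r ∈ S,
    Relation.TransGen (fun x y => Odd (f x) ∧ Odd (f y) ∧ M.OddRankSim x y) p r → f p ≤ f r

/-- The RankSim' condition, using the statically computed relation `⪯^R` instead of
the odd-rank simulation. -/
def RankSimCondR (M : BA A Q) (S : Set Q) (f : Q → ℕ) : Prop :=
  ∀ p ∈ S, ∀ r ∈ S,
    Relation.TransGen (fun x y => Odd (f x) ∧ Odd (f y) ∧ M.RatSim x y) p r → f p ≤ f r

/-! ### The RankRestr optimization -/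

/-- The `RankRestr(M)` automaton: `Schewe(M)` with the tight-part transitions
restricted to those where every odd-ranked state has a successor of the same rank. -/
def rankRestr (M : BA A Q) : BA A (Mac Q) :=
  ⟨fun m a => {m' | m' ∈ M.scheweDelta m a ∧
      ∀ S O f i S' O' f' i', m = Mac.tight S O f i → m' = Mac.tight S' O' f' i' →
        ∀ q ∈ S, Odd (f q) → ∃ q' ∈ M.δ q a, f' q' = f q},
   {Mac.wait M.I}, M.scheweAccept⟩

/-! ### The MaxRank construction -/

/-- The auxiliary transition function `η#`: the waiting-to-tight transitions of
`Delay(M)` whose targets satisfy RankSim' and SuccRank. -/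
def EtaAux (M : BA A Q) (S : Set Q) (a : A) : Set (Mac Q) :=
  {m | M.ClosesCycle S a ∧
       ∃ f, m = Mac.tight (M.δS S a) ∅ f 0 ∧ M.InQ2 (M.δS S a) ∅ f 0 ∧
         M.RankSimCondR (M.δS S a) f ∧ M.CondCoarse (M.δS S a) f ∧ M.CondFine (M.δS S a) f}

/-- The order on macrostates used for `η₂`: macrostates with the same `S`, `O` and `i`
components are compared by their rankings, pointwise. -/
def MacLE : Mac Q → Mac Q → Prop
  | Mac.wait S, Mac.wait S' => S = S'
  | Mac.tight S O f i, Mac.tight S' O' g i' => S = S' ∧ O = O' ∧ i = i' ∧ ∀ q, f q ≤ g q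
  | _, _ => False

/-- `η₂`: the maximal elements of `η#` with respect to the pointwise order on rankings. -/
def eta2 (M : BA A Q) (S : Set Q) (a : A) : Set (Mac Q) :=
  {m | m ∈ M.EtaAux S a ∧ ∀ m' ∈ M.EtaAux S a, MacLE m m' → MacLE m' m}

/-- The maximal successor ranking of `(S, f)` under letter `a`: for
`q' ∈ δ(S,a)`, with `r = min {f s : s ∈ δ⁻¹(q',a) ∩ S}`, it is `r − 1` if `r` is odd
and `q' ∈ F`, and `r` otherwise; it is `0` outside `δ(S,a)`. -/
def fmax (M : BA A Q) (S : Set Q) (f : Q → ℕ) (a : A) (q' : Q) : ℕ :=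
  if q' ∈ M.δS S a then
    let r := sInf {n | ∃ s ∈ S, q' ∈ M.δ s a ∧ f s = n}
    if Odd r ∧ q' ∈ M.F then r - 1 else r
  else 0

/-- `η₃`: the (at most one) `δ₃`-successor carrying the maximal successor ranking. -/
def eta3 (M : BA A Q) (S O : Set Q) (f : Q → ℕ) (i : ℕ) (a : A) : Set (Mac Q) :=
  {m | ∃ S' O' i', m = Mac.tight S' O' (M.fmax S f a) i' ∧
       m ∈ M.scheweDelta (Mac.tight S O f i) a}

/-- `η₄`: obtained from the `η₃`-successor `(S', P', h', i')` by decreasing the rank of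
every non-accepting state of `P'` by one (defined only when `i' ≠ 0`). -/
def eta4 (M : BA A Q) (S O : Set Q) (f : Q → ℕ) (i : ℕ) (a : A) : Set (Mac Q) :=
  {m | ∃ S' P' h' i', Mac.tight S' P' h' i' ∈ M.eta3 S O f i a ∧ i' ≠ 0 ∧
       m = Mac.tight S'
         (P' ∩ {q | (if q ∈ P' ∧ q ∉ M.F then h' q - 1 else h' q) = i'})
         (fun u => if u ∈ P' ∧ u ∉ M.F then h' u - 1 else h' u) i'}

/-- The transition function of `MaxRank(M)`. -/
def maxRankDelta (M : BA A Q) : Mac Q → A → Set (Mac Q)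
  | .wait S, a => {Mac.wait (M.δS S a)} ∪ M.eta2 S a
  | .tight S O f i, a => M.eta3 S O f i a ∪ M.eta4 S O f i a

/-- The `MaxRank(M)` automaton. -/
def maxRank (M : BA A Q) : BA A (Mac Q) :=
  ⟨M.maxRankDelta, {Mac.wait M.I}, M.scheweAccept⟩

end BA

/-! ### Statement -/

namespace BA

theorem dagG_succ_sub {A Q : Type*} (M : BA A Q) (w : ℕ → A) (j : ℕ) :
    M.dagG w (j + 1) ⊆ M.dagG w j := by
  intro v hv
  rw [dagG] at hv
  split_ifs at hv <;> exact hv.1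

theorem dagG_anti {A Q : Type*} (M : BA A Q) (w : ℕ → A) : Antitone (M.dagG w) :=
  antitone_nat_of_succ_le (M.dagG_succ_sub w)

theorem dagG_even {A Q : Type*} (M : BA A Q) (w : ℕ → A) {j : ℕ} (hj : Even j) (v : Q × ℕ) :
    v ∈ M.dagG w (j + 1) ↔ v ∈ M.dagG w j ∧
      ¬ Set.Finite {v' | M.reachIn w (M.dagG w j) v v'} := by
  rw [dagG, if_pos hj]; rfl

theorem dagG_odd {A Q : Type*} (M : BA A Q) (w : ℕ → A) {j : ℕ} (hj : ¬ Even j) (v : Q × ℕ) :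
    v ∈ M.dagG w (j + 1) ↔ v ∈ M.dagG w j ∧
      ∃ v', M.reachIn w (M.dagG w j) v v' ∧ v'.1 ∈ M.F := by
  rw [dagG, if_neg hj]; rfl

theorem dagRank_iff {A Q : Type*} (M : BA A Q) (w : ℕ → A) (v : Q × ℕ) (n : ℕ) :
    M.dagRank w v = (n : ℕ∞) ↔ v ∈ M.dagG w n ∧ v ∉ M.dagG w (n + 1) := by
  constructor
  · intro h
    have hne : {j : ℕ∞ | ∃ n : ℕ, j = (n : ℕ∞) ∧ v ∈ M.dagG w n ∧
        v ∉ M.dagG w (n + 1)}.Nonempty := by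
      rw [Set.nonempty_iff_ne_empty]
      intro he
      rw [dagRank, he, sInf_empty] at h
      exact absurd h (by simp)
    have := csInf_mem hne
    obtain ⟨m, hm, h1, h2⟩ := this
    have : (n : ℕ∞) = m := by rw [← h, ← hm]; rfl
    have : n = m := by exact_mod_cast this
    subst this
    exact ⟨h1, h2⟩
  · rintro ⟨h1, h2⟩
    have : {j : ℕ∞ | ∃ n : ℕ, j = (n : ℕ∞) ∧ v ∈ M.dagG w n ∧
        v ∉ M.dagG w (n + 1)} = {(n : ℕ∞)} := by
      ext j
      constructor
      · rintro ⟨m, rfl, h3, h4⟩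
        have : m = n := by
          rcases lt_trichotomy m n with h | h | h
          · exact absurd (M.dagG_anti w (Nat.succ_le_of_lt h) h1) h4
          · exact h
          · exact absurd (M.dagG_anti w (Nat.succ_le_of_lt h) h3) h2
        rw [this]; rfl
      · rintro rfl
        exact ⟨n, rfl, h1, h2⟩
    rw [dagRank, this, sInf_singleton]

theorem sim_seq {A Q : Type*} (M : BA A Q) {R : Q → Q → Prop} (hR : M.IsDirSimRel R)
    (u : ℕ → A) (τ : ℕ → Q) (hτ : ∀ k, τ (k + 1) ∈ M.δ (τ k) (u k)) (r : Q) (h0 : R (τ 0) r) :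
    ∃ σ : ℕ → Q, σ 0 = r ∧ ∀ k, σ (k + 1) ∈ M.δ (σ k) (u k) := by
  have step : ∀ k, ∀ x : {x // R (τ k) x}, ∃ y : {y // R (τ (k + 1)) y},
      y.1 ∈ M.δ x.1 (u k) := by
    rintro k ⟨x, hx⟩
    obtain ⟨y, hy, hy'⟩ := (hR _ _ hx).2 (u k) _ (hτ k)
    exact ⟨⟨y, hy'⟩, hy⟩
  choose f hf using step
  let s : ∀ k, {x // R (τ k) x} := fun k => Nat.rec ⟨r, h0⟩ (fun k x => f k x) k
  exact ⟨fun k => (s k).1, rfl, fun k => hf k (s k)⟩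

theorem sim_edge {A Q : Type*} (M : BA A Q) {R : Q → Q → Prop} (hR : M.IsDirSimRel R)
    (w : ℕ → A) {u v : Q × ℕ} {r : Q} (h : R u.1 r) (hr : (r, u.2) ∈ M.dagV w)
    (he : M.dagEdge w u v) : ∃ r', R v.1 r' ∧ M.dagEdge w (r, u.2) (r', v.2) := by
  obtain ⟨p, i⟩ := u
  obtain ⟨p', i'⟩ := v
  obtain ⟨hu, ⟨ρ, hρ, hρi⟩, h2, h3⟩ := he
  simp only at *
  subst h2
  obtain ⟨r', hr', hR'⟩ := (hR _ _ h).2 _ _ h3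
  refine ⟨r', hR', hr, ?_, rfl, hr'⟩
  obtain ⟨σ, hσ0, hσ⟩ := M.sim_seq hR (fun k => w (i + 1 + k)) (fun k => ρ (i + 1 + k))
    (fun k => hρ.2 (i + 1 + k)) r' (by simpa [hρi] using hR')
  obtain ⟨ρ', hρ', hρ'i⟩ := hr
  simp only at hρ'i
  refine ⟨fun j => if j ≤ i then ρ' j else σ (j - (i + 1)), ⟨?_, ?_⟩, ?_⟩
  · simpa using hρ'.1
  · intro j
    rcases lt_trichotomy j i with hj | hj | hj
    · simp only [if_pos hj.le, if_pos (Nat.succ_le_of_lt hj)]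
      exact hρ'.2 j
    · subst hj
      simp [hρ'i, hσ0, hr']
    · obtain ⟨k, rfl⟩ := Nat.exists_eq_add_of_le (Nat.succ_le_of_lt hj)
      have e1 : ¬ (i.succ + k + 1 ≤ i) := by omega
      have e2 : ¬ (i.succ + k ≤ i) := by omega
      have e3 : i.succ + k + 1 - (i + 1) = k + 1 := by omega
      have e4 : i.succ + k - (i + 1) = k := by omega
      simp only [if_neg e1, if_neg e2, e3, e4]
      exact hσ k
  · simp [hσ0]

theorem sim_reach {A Q : Type*} (M : BA A Q) {R : Q → Q → Prop} (hR : M.IsDirSimRel R)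
    (w : ℕ → A) (U : Set (Q × ℕ))
    (hU : ∀ p r i, R p r → (r, i) ∈ M.dagV w → (p, i) ∈ U → (r, i) ∈ U)
    {u v : Q × ℕ} {r : Q} (h : R u.1 r) (hr : (r, u.2) ∈ M.dagV w)
    (he : M.reachIn w U u v) :
    ∃ r', R v.1 r' ∧ (r', v.2) ∈ M.dagV w ∧ M.reachIn w U (r, u.2) (r', v.2) := by
  obtain ⟨hu, he⟩ := he
  induction he with
  | refl => exact ⟨r, h, hr, hU _ _ _ h hr hu, .refl⟩
  | @tail x y _ hxy ih =>
    obtain ⟨r1, h1, h2, h3⟩ := ih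
    obtain ⟨r2, h4, h5⟩ := M.sim_edge hR w h1 h2 hxy.2
    exact ⟨r2, h4, h5.2.1, h3.1, h3.2.tail ⟨hU _ _ _ h4 h5.2.1 hxy.1, h5⟩⟩

theorem finite_reach {A Q : Type*} [Finite Q] {S T : Set (Q × ℕ)}
    (h : ∀ v ∈ S, ∃ r, (r, v.2) ∈ T) (hT : T.Finite) : S.Finite := by
  have h1 : (Set.univ ×ˢ (Prod.snd '' T) : Set (Q × ℕ)).Finite :=
    Set.finite_univ.prod (hT.image _)
  refine h1.subset ?_
  intro v hv
  obtain ⟨r, hr⟩ := h v hv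
  exact ⟨trivial, _, hr, rfl⟩

theorem sim_dagG {A Q : Type*} [Finite Q] (M : BA A Q) {R : Q → Q → Prop}
    (hR : M.IsDirSimRel R) (w : ℕ → A) (j : ℕ) :
    ∀ p r i, R p r → (r, i) ∈ M.dagV w → (p, i) ∈ M.dagG w j → (r, i) ∈ M.dagG w j := by
  induction j with
  | zero => intro p r i _ hr _; exact hr
  | succ j ih =>
    intro p r i h hr hp
    by_cases hj : Even j
    · rw [dagG_even M w hj] at hp ⊢
      refine ⟨ih _ _ _ h hr hp.1, fun hfin => hp.2 ?_⟩
      refine finite_reach (A := A) ?_ hfin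
      intro v hv
      obtain ⟨r', _, _, h3⟩ := M.sim_reach hR w _ ih h hr hv
      exact ⟨r', h3⟩
    · rw [dagG_odd M w hj] at hp ⊢
      refine ⟨ih _ _ _ h hr hp.1, ?_⟩
      obtain ⟨_, v, hv, hF⟩ := hp
      obtain ⟨r', h1, _, h3⟩ := M.sim_reach hR w _ ih h hr hv
      exact ⟨_, h3, (hR _ _ h1).1 hF⟩

theorem odd_succ {A Q : Type*} [Finite Q] (M : BA A Q) (w : ℕ → A) (p : Q) (i n : ℕ)
    (hn : Odd n) (h : M.dagRank w (p, i) = (n : ℕ∞)) :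
    ∃ q ∈ M.δ p (w i) \ M.F, (q, i + 1) ∈ M.dagV w ∧ M.dagRank w (q, i + 1) = (n : ℕ∞) := by
  rw [dagRank_iff] at h
  obtain ⟨h1, h2⟩ := h
  have hne : ¬ Even n := Nat.not_even_iff_odd.2 hn
  obtain ⟨m, rfl⟩ : ∃ m, n = m + 1 := ⟨n - 1, by have := hn.pos; omega⟩
  have hm : Even m := by
    by_contra hc
    exact hne (Nat.even_add_one.2 hc)
  obtain ⟨h3, h4⟩ := (M.dagG_even w hm _).1 h1
  -- successor with infinite reach
  obtain ⟨q, hq, hqG, hqE⟩ : ∃ q, (q, i + 1) ∈ M.dagG w (m + 1) ∧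
      (q, i + 1) ∈ M.dagG w m ∧ M.dagEdge w (p, i) (q, i + 1) := by
    by_contra hc
    push Not at hc
    apply h4
    have hfin : (⋃ q ∈ {q : Q | (q, i + 1) ∈ M.dagG w m ∧ M.dagEdge w (p, i) (q, i + 1)},
        {v' | M.reachIn w (M.dagG w m) (q, i + 1) v'}).Finite := by
      refine Set.Finite.biUnion (Set.toFinite _) ?_
      rintro q ⟨hq1, hq2⟩
      by_contra hinf
      exact hc q ((M.dagG_even w hm _).2 ⟨hq1, hinf⟩) hq1 hq2
    refine (hfin.insert (p, i)).subset ?_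
    rintro v ⟨_, hv⟩
    rcases Relation.ReflTransGen.cases_head hv with rfl | ⟨⟨q, k⟩, ⟨hx1, hx2⟩, hx3⟩
    · exact Set.mem_insert _ _
    · have hk : k = i + 1 := hx2.2.2.1
      subst hk
      refine Set.mem_insert_of_mem _ ?_
      simp only [Set.mem_iUnion]
      exact ⟨q, ⟨hx1, hx2⟩, hx1, hx3⟩
  have hno : (q, i + 1) ∉ M.dagG w (m + 1 + 1) := by
    intro hc
    obtain ⟨_, v, hv, hF⟩ := (M.dagG_odd w hne _).1 hc
    exact h2 ((M.dagG_odd w hne _).2 ⟨h1, v, ⟨h1, hv.2.head ⟨hq, hqE⟩⟩, hF⟩)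
  refine ⟨q, ⟨hqE.2.2.2, fun hF => hno ?_⟩, hqE.2.1, (M.dagRank_iff w _ _).2 ⟨hq, hno⟩⟩
  exact (M.dagG_odd w hne _).2 ⟨hq, _, ⟨hq, .refl⟩, hF⟩

end BA

open BA

theorem stmt12 {A Q : Type*} [Fintype A] [Nonempty A] [Fintype Q] (M : BA A Q)
    (p r : Q) (h : M.RatSim p r) : M.OddRankSim p r := by
  induction h with
  | base h =>
    obtain ⟨R, hR, h⟩ := h
    intro w i hp hr np nr h1 h2 _ _
    rw [dagRank_iff] at h1 h2
    by_contra hlt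
    push Not at hlt
    exact h2.2 (M.sim_dagG hR w _ _ _ _ h hr (M.dagG_anti w (Nat.succ_le_of_lt hlt) h1.1))
  | step _ ih =>
    intro w i hp hr np nr h1 h2 o1 o2
    obtain ⟨x, hx, hxV, hxr⟩ := M.odd_succ w _ _ _ o1 h1
    obtain ⟨y, hy, hyV, hyr⟩ := M.odd_succ w _ _ _ o2 h2
    exact ih _ x hx y hy w (i + 1) hxV hyV np nr hxr hyr o1 o2
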